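/- arXiv:2501.06620 — 3 statements merged into one kernel-verified Lean document; each statement's English description precedes it below -/
import Mathlib

section
/- Let N ≥ 1 be a natural number and K ≥ 0 an even natural number. Let x_1,…,x_N ∈ [−1,1] and x_i' ∈ [−1,1], and let D' be the dataset obtained from D = (x_1,…,x_N) by replacing the i-th entry x_i with x_i'. Writing μ_j(D) = (1/N)·Σ_{n=1}^N x_n^j for the j-th empirical moment, the Euclidean (ℓ₂) norm of the vector (μ_1(D)−μ_1(D'), μ_2(D)−μ_2(D'), …, μ_{K+1}(D)−μ_{K+1}(D')) is at most √((5K+8)/(2N²)). -/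
open Finset

/-- The `j`-th empirical moment of a dataset of `N` reals. -/
noncomputable def empMoment {N : ℕ} (x : Fin N → ℝ) (j : ℕ) : ℝ :=
  (1 / (N : ℝ)) * ∑ n, x n ^ j

lemma pow_mem_aux (a : ℝ) (ha : a ∈ Set.Icc (-1 : ℝ) 1) (j : ℕ) :
    -1 ≤ a ^ j ∧ a ^ j ≤ 1 := by
  have h : |a| ≤ 1 := abs_le.2 ⟨ha.1, ha.2⟩
  have h2 : |a ^ j| ≤ 1 := by
    rw [abs_pow]
    exact pow_le_one₀ (abs_nonneg a) h
  exact abs_le.1 h2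

lemma sq_any_aux (a b : ℝ) (ha : a ∈ Set.Icc (-1 : ℝ) 1) (hb : b ∈ Set.Icc (-1 : ℝ) 1)
    (j : ℕ) : (a ^ j - b ^ j) ^ 2 ≤ 4 := by
  obtain ⟨h1, h2⟩ := pow_mem_aux a ha j
  obtain ⟨h3, h4⟩ := pow_mem_aux b hb j
  nlinarith

lemma sq_even_aux (a b : ℝ) (ha : a ∈ Set.Icc (-1 : ℝ) 1) (hb : b ∈ Set.Icc (-1 : ℝ) 1)
    (j : ℕ) (hj : Even j) : (a ^ j - b ^ j) ^ 2 ≤ 1 := by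
  obtain ⟨h1, h2⟩ := pow_mem_aux a ha j
  obtain ⟨h3, h4⟩ := pow_mem_aux b hb j
  have h5 := hj.pow_nonneg a
  have h6 := hj.pow_nonneg b
  nlinarith

lemma sum_aux (a b : ℝ) (ha : a ∈ Set.Icc (-1 : ℝ) 1) (hb : b ∈ Set.Icc (-1 : ℝ) 1)
    (m : ℕ) : ∑ j ∈ Finset.range (m + m + 1), (a ^ (j + 1) - b ^ (j + 1)) ^ 2
      ≤ 5 * (m : ℝ) + 4 := by
  induction m with
  | zero => simpa using sq_any_aux a b ha hb 1
  | succ k ih =>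
    rw [show k + 1 + (k + 1) + 1 = (k + k + 1) + 1 + 1 by ring, Finset.sum_range_succ,
      Finset.sum_range_succ]
    have h1 := sq_even_aux a b ha hb (k + k + 1 + 1) ⟨k + 1, by ring⟩
    have h2 := sq_any_aux a b ha hb (k + k + 1 + 1 + 1)
    push_cast
    linarith

lemma diff_aux {N : ℕ} (x : Fin N → ℝ) (i : Fin N) (x' : ℝ) (j : ℕ) :
    empMoment x j - empMoment (Function.update x i x') j
      = (1 / (N : ℝ)) * (x i ^ j - x' ^ j) := by
  unfold empMoment
  rw [← mul_sub, ← Finset.sum_sub_distrib, Finset.sum_eq_single i]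
  · simp
  · intro n _ hn
    simp [Function.update_of_ne hn]
  · simp

/-- Sensitivity of the first `K+1` empirical moments for even `K`:
replacing one entry of the dataset changes the vector of moments
`(μ_1, …, μ_{K+1})` by at most `√((5K+8)/(2N²))` in `ℓ₂` norm. -/
theorem moment_sensitivity_even
    (N K : ℕ) (hN : 1 ≤ N) (hK : Even K)
    (x : Fin N → ℝ) (hx : ∀ n, x n ∈ Set.Icc (-1 : ℝ) 1)
    (i : Fin N) (x' : ℝ) (hx' : x' ∈ Set.Icc (-1 : ℝ) 1) :
    Real.sqrt (∑ j ∈ Finset.range (K + 1),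
        (empMoment x (j + 1) - empMoment (Function.update x i x') (j + 1)) ^ 2)
      ≤ Real.sqrt ((5 * (K : ℝ) + 8) / (2 * (N : ℝ) ^ 2)) := by
  obtain ⟨m, rfl⟩ := hK
  apply Real.sqrt_le_sqrt
  simp only [diff_aux, mul_pow]
  rw [← Finset.mul_sum]
  have hs := sum_aux (x i) x' (hx i) hx' m
  have hN0 : (0 : ℝ) < N := by exact_mod_cast hN
  calc _ ≤ (1 / (N : ℝ)) ^ 2 * (5 * (m : ℝ) + 4) := by gcongr
    _ = _ := by
      push_cast
      field_simp
      ring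
end

section
/- Let N ≥ 1 and let x_1,…,x_N ∈ [−1,1], with empirical CDF F and empirical moments μ_j. Then for every natural number k with 0 ≤ k ≤ K, the inner product ∫_{−1}^1 F(x)·e_k(x) dx equals α_k·Σ_{i=0}^k β_{k,i}·(1 − μ_{i+1}), where α_k = 2^k·√((2k+1)/2) and β_{k,i} = (1/(i+1))·C(k,i)·C((k+i−1)/2, k). -/
open Finset

/-- Generalized binomial coefficient `C(a,k) = a(a-1)⋯(a-k+1)/k!`. -/
noncomputable def genChoose (a : ℝ) (k : ℕ) : ℝ :=
  (∏ j ∈ Finset.range k, (a - (j : ℝ))) / (Nat.factorial k : ℝ)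

/-- The `k`-th Legendre polynomial in explicit form:
`P_k(x) = 2^k ∑_{i=0}^k C(k,i) C((k+i-1)/2, k) x^i`. -/
noncomputable def legendreP (k : ℕ) (x : ℝ) : ℝ :=
  2 ^ k * ∑ i ∈ Finset.range (k + 1),
    (Nat.choose k i : ℝ) * genChoose (((k : ℝ) + (i : ℝ) - 1) / 2) k * x ^ i

/-- The `k`-th orthonormal Legendre basis function `e_k(x) = √((2k+1)/2) P_k(x)`. -/
noncomputable def legendreE (k : ℕ) (x : ℝ) : ℝ :=
  Real.sqrt ((2 * (k : ℝ) + 1) / 2) * legendreP k x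

/-- `α_k = 2^k √((2k+1)/2)`. -/
noncomputable def coefA (k : ℕ) : ℝ := 2 ^ k * Real.sqrt ((2 * (k : ℝ) + 1) / 2)

/-- `β_{k,i} = (1/(i+1)) C(k,i) C((k+i-1)/2, k)`. -/
noncomputable def coefB (k i : ℕ) : ℝ :=
  (1 / ((i : ℝ) + 1)) * (Nat.choose k i : ℝ) * genChoose (((k : ℝ) + (i : ℝ) - 1) / 2) k

/-- The empirical cumulative distribution function of a dataset of `N` reals. -/
noncomputable def eCDF {N : ℕ} (x : Fin N → ℝ) (t : ℝ) : ℝ :=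
  (1 / (N : ℝ)) * ∑ n, (if x n ≤ t then (1 : ℝ) else 0)

/-- The optimal polynomial approximation `F̂` of the empirical CDF:
`F̂(x) = ∑_{k=0}^K α_k (∑_{i=0}^k β_{k,i} (1 - μ_{i+1})) e_k(x)`. -/
noncomputable def Fhat {N : ℕ} (x : Fin N → ℝ) (K : ℕ) (t : ℝ) : ℝ :=
  ∑ k ∈ Finset.range (K + 1),
    coefA k * (∑ i ∈ Finset.range (k + 1), coefB k i * (1 - empMoment x (i + 1))) *
      legendreE k t

lemma step_integrable (a : ℝ) (i : ℕ) :
    IntervalIntegrable (fun t : ℝ => (if a ≤ t then (1 : ℝ) else 0) * t ^ i)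
      MeasureTheory.volume (-1) 1 := by
  have h : (fun t : ℝ => (if a ≤ t then (1 : ℝ) else 0) * t ^ i)
      = Set.indicator (Set.Ici a) (fun t : ℝ => t ^ i) := by
    funext t
    simp [Set.indicator_apply]
  rw [h]
  have hc : IntervalIntegrable (fun t : ℝ => t ^ i) MeasureTheory.volume (-1) 1 :=
    (continuous_pow i).intervalIntegrable _ _
  exact ⟨hc.1.indicator measurableSet_Ici, hc.2.indicator measurableSet_Ici⟩

lemma step_integral (a : ℝ) (ha : a ∈ Set.Icc (-1 : ℝ) 1) (i : ℕ) :
    ∫ t in (-1 : ℝ)..1, (if a ≤ t then (1 : ℝ) else 0) * t ^ i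
      = (1 - a ^ (i + 1)) / ((i : ℝ) + 1) := by
  have hint := step_integrable a i
  have h1 : IntervalIntegrable (fun t : ℝ => (if a ≤ t then (1 : ℝ) else 0) * t ^ i)
      MeasureTheory.volume (-1) a := by
    apply hint.mono_set
    rw [Set.uIcc_of_le ha.1, Set.uIcc_of_le (by norm_num)]
    exact Set.Icc_subset_Icc_right ha.2
  have h2 : IntervalIntegrable (fun t : ℝ => (if a ≤ t then (1 : ℝ) else 0) * t ^ i)
      MeasureTheory.volume a 1 := by
    apply hint.mono_set
    rw [Set.uIcc_of_le ha.2, Set.uIcc_of_le (by norm_num)]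
    exact Set.Icc_subset_Icc_left ha.1
  rw [← intervalIntegral.integral_add_adjacent_intervals h1 h2]
  have e1 : ∫ t in (-1 : ℝ)..a, (if a ≤ t then (1 : ℝ) else 0) * t ^ i = 0 := by
    rw [intervalIntegral.integral_of_le ha.1, MeasureTheory.integral_Ioc_eq_integral_Ioo]
    rw [MeasureTheory.setIntegral_congr_fun (g := fun _ => (0 : ℝ)) measurableSet_Ioo]
    · simp
    · intro t ht
      simp [not_le.mpr ht.2]
  have e2 : ∫ t in a..(1 : ℝ), (if a ≤ t then (1 : ℝ) else 0) * t ^ i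
      = ∫ t in a..(1 : ℝ), t ^ i := by
    apply intervalIntegral.integral_congr
    intro t ht
    rw [Set.uIcc_of_le ha.2] at ht
    simp [ht.1]
  rw [e1, e2, integral_pow]
  simp

/-- The Legendre coefficient of the empirical CDF:
`(F|e_k) = ∫_{-1}^1 F(x) e_k(x) dx = α_k ∑_{i=0}^k β_{k,i} (1 - μ_{i+1})` for `0 ≤ k ≤ K`. -/
theorem ecdf_legendre_coefficient
    (N : ℕ) (hN : 1 ≤ N)
    (x : Fin N → ℝ) (hx : ∀ n, x n ∈ Set.Icc (-1 : ℝ) 1)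
    (K k : ℕ) (hk : k ≤ K) :
    ∫ t in (-1 : ℝ)..1, eCDF x t * legendreE k t
      = coefA k * ∑ i ∈ Finset.range (k + 1), coefB k i * (1 - empMoment x (i + 1)) := by
  have hN0 : (N : ℝ) ≠ 0 := by
    have : 0 < N := hN
    positivity
  have hf : ∀ t : ℝ, eCDF x t * legendreE k t
      = ∑ i ∈ Finset.range (k + 1), ∑ n : Fin N,
        (coefA k * ((Nat.choose k i : ℝ) * genChoose (((k : ℝ) + (i : ℝ) - 1) / 2) k)
          * (1 / (N : ℝ))) * ((if x n ≤ t then (1 : ℝ) else 0) * t ^ i) := by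
    intro t
    unfold eCDF legendreE legendreP coefA
    simp_rw [← Finset.mul_sum, ← Finset.sum_mul]
    simp only [Finset.mul_sum]
    apply Finset.sum_congr rfl
    intro i _
    rw [← Finset.mul_sum]
    ring
  simp_rw [hf]
  rw [intervalIntegral.integral_finsetSum]
  · rw [Finset.mul_sum]
    apply Finset.sum_congr rfl
    intro i _
    rw [intervalIntegral.integral_finsetSum]
    · simp_rw [intervalIntegral.integral_const_mul, step_integral _ (hx _) i]
      rw [← Finset.mul_sum, ← Finset.sum_div, Finset.sum_sub_distrib]
      unfold coefB empMoment
      simp only [Finset.sum_const, Finset.card_univ, Fintype.card_fin, nsmul_eq_mul, mul_one]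
      have hi : (i : ℝ) + 1 ≠ 0 := by positivity
      field_simp
    · intro n _
      exact (step_integrable _ _).const_mul _
  · intro i _
    have hs := IntervalIntegrable.sum (a := (-1 : ℝ)) (b := 1) (μ := MeasureTheory.volume)
      Finset.univ (f := fun (n : Fin N) (t : ℝ) =>
        (coefA k * ((Nat.choose k i : ℝ) * genChoose (((k : ℝ) + (i : ℝ) - 1) / 2) k)
          * (1 / (N : ℝ))) * ((if x n ≤ t then (1 : ℝ) else 0) * t ^ i))
      (fun n _ => (step_integrable _ _).const_mul _)
    rw [Finset.sum_fn] at hs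
    exact hs
end

section
/- Let N ≥ 1, let x_1,…,x_N ∈ [−1,1] with empirical CDF F and empirical moments μ_j, and let K be a natural number. Define F̂(x) = Σ_{k=0}^K α_k·(Σ_{i=0}^k β_{k,i}·(1 − μ_{i+1}))·e_k(x), where α_k = 2^k·√((2k+1)/2) and β_{k,i} = (1/(i+1))·C(k,i)·C((k+i−1)/2, k). Then F̂ is the best L²-approximation of F among polynomials of degree at most K: for every real polynomial g of degree at most K, ∫_{−1}^1 (F(x) − F̂(x))² dx ≤ ∫_{−1}^1 (F(x) − g(x))² dx. -/
open Finset

open Polynomial in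
lemma aux_poly (k : ℕ) (r : ℝ[X]) (hr : r.natDegree < k) :
    ∑ i ∈ Finset.range (k + 1), (-1 : ℝ) ^ (k - i) * (k.choose i : ℝ) * r.eval (i : ℝ) = 0 := by
  have h := congrFun (Polynomial.fwdDiff_iter_eq_zero_of_degree_lt hr) 0
  rw [fwdDiff_iter_eq_sum_shift] at h
  simpa [zsmul_eq_mul] using h

lemma aux_inv_diff (k : ℕ) : ∀ y : ℝ, 0 < y →
    (fwdDiff (1 : ℝ))^[k] (fun z : ℝ => z⁻¹) y
      = (-1) ^ k * (k.factorial : ℝ) / ∏ j ∈ Finset.range (k + 1), (y + (j : ℝ)) := by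
  induction k with
  | zero => intro y hy; simp
  | succ k ih =>
    intro y hy
    rw [Function.iterate_succ_apply', fwdDiff, ih _ (by linarith), ih _ hy]
    have e1 : ∏ j ∈ Finset.range (k + 1 + 1), (y + (j : ℝ))
        = (∏ j ∈ Finset.range (k + 1), (y + (j : ℝ))) * (y + (k + 1)) := by
      rw [Finset.prod_range_succ]; push_cast; rfl
    have e2 : (∏ j ∈ Finset.range (k + 1), (y + 1 + (j : ℝ))) * y
        = (∏ j ∈ Finset.range (k + 1), (y + (j : ℝ))) * (y + (k + 1)) := by
      rw [← e1, Finset.prod_range_succ' _ (k + 1)]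
      simp only [Nat.cast_zero, add_zero]
      congr 1
      refine Finset.prod_congr rfl fun j _ => ?_
      push_cast; ring
    have p1 : 0 < ∏ j ∈ Finset.range (k + 1), (y + (j : ℝ)) :=
      Finset.prod_pos fun j _ => by positivity
    have p2 : 0 < ∏ j ∈ Finset.range (k + 1), (y + 1 + (j : ℝ)) :=
      Finset.prod_pos fun j _ => by positivity
    rw [e1, Nat.factorial_succ]
    generalize (∏ j ∈ Finset.range (k + 1), (y + (j : ℝ))) = A at *
    generalize (∏ j ∈ Finset.range (k + 1), (y + 1 + (j : ℝ))) = B at *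
    have hB : B = A * (y + (k + 1)) / y := by field_simp; linarith
    have : 0 < y + (k + 1) := by positivity
    rw [hB]
    field_simp
    push_cast
    ring

lemma aux_inv (k : ℕ) (y : ℝ) (hy : 0 < y) :
    ∑ i ∈ Finset.range (k + 1), (-1 : ℝ) ^ (k - i) * (k.choose i : ℝ) * ((i : ℝ) + y)⁻¹
      = (-1) ^ k * (k.factorial : ℝ) / ∏ j ∈ Finset.range (k + 1), (y + (j : ℝ)) := by
  rw [← aux_inv_diff k y hy, fwdDiff_iter_eq_sum_shift]
  refine Finset.sum_congr rfl fun i _ => ?_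
  simp [zsmul_eq_mul, add_comm]

open Polynomial in
lemma aux_main (k : ℕ) (q : ℝ[X]) (hq : q.natDegree ≤ k) (y : ℝ) (hy : 0 < y) :
    ∑ i ∈ Finset.range (k + 1), (-1 : ℝ) ^ (k - i) * (k.choose i : ℝ) * (q.eval (i : ℝ) / (i + y))
      = q.eval (-y) * ((-1) ^ k * (k.factorial : ℝ) /
          ∏ j ∈ Finset.range (k + 1), (y + (j : ℝ))) := by
  have hd := modByMonic_add_div q (X - C (-y))
  rw [modByMonic_X_sub_C_eq_C_eval] at hd
  set r := q /ₘ (X - C (-y)) with hr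
  have hz : ∑ i ∈ Finset.range (k + 1),
      (-1 : ℝ) ^ (k - i) * (k.choose i : ℝ) * r.eval (i : ℝ) = 0 := by
    rcases Nat.eq_zero_or_pos k with h0 | h0
    · have : r = 0 := by
        rw [hr, divByMonic_eq_zero_iff (monic_X_sub_C _), degree_X_sub_C]
        rw [h0] at hq
        exact lt_of_le_of_lt (natDegree_le_iff_degree_le.mp hq) (by norm_num)
      simp [this]
    · apply aux_poly
      rw [hr, natDegree_divByMonic _ (monic_X_sub_C _), natDegree_X_sub_C]
      omega
  rw [← aux_inv k y hy, Finset.mul_sum, ← add_zero (∑ i ∈ _, q.eval (-y) * _), ← hz,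
    ← Finset.sum_add_distrib]
  refine Finset.sum_congr rfl fun i _ => ?_
  have hi : (i : ℝ) + y ≠ 0 := by positivity
  have he : q.eval (i : ℝ) = q.eval (-y) + (i + y) * r.eval (i : ℝ) := by
    conv_lhs => rw [← hd]
    simp
  rw [he]
  field_simp

lemma genChoose_zero (k i : ℕ) (hi : i ≤ k) (h : ¬ Even (k + i)) :
    genChoose (((k : ℝ) + (i : ℝ) - 1) / 2) k = 0 := by
  obtain ⟨j, hj⟩ := Nat.not_even_iff_odd.mp h
  unfold genChoose
  rw [Finset.prod_eq_zero (i := j) (by simp; omega), zero_div]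
  have : (k : ℝ) + i = 2 * j + 1 := by exact_mod_cast hj
  rw [this]; ring

lemma continuous_legendreP (k : ℕ) : Continuous (legendreP k) := by
  unfold legendreP; fun_prop

lemma mom (m k : ℕ) : ∫ t in (-1 : ℝ)..1, t ^ m * legendreP k t
    = 2 ^ k * ∑ i ∈ Finset.range (k + 1),
      (Nat.choose k i : ℝ) * genChoose (((k : ℝ) + (i : ℝ) - 1) / 2) k *
        ((1 - (-1) ^ (m + i + 1)) / ((i : ℝ) + (m + 1))) := by
  have : ∀ t : ℝ, t ^ m * legendreP k t = 2 ^ k * ∑ i ∈ Finset.range (k + 1),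
      (Nat.choose k i : ℝ) * genChoose (((k : ℝ) + (i : ℝ) - 1) / 2) k * t ^ (m + i) := by
    intro t
    unfold legendreP
    rw [mul_left_comm, Finset.mul_sum]
    congr 1
    refine Finset.sum_congr rfl fun i _ => ?_
    ring
  simp_rw [this]
  rw [intervalIntegral.integral_const_mul, intervalIntegral.integral_finsetSum]
  · congr 1
    refine Finset.sum_congr rfl fun i _ => ?_
    rw [intervalIntegral.integral_const_mul, integral_pow]
    congr 1
    push_cast
    rw [one_pow]
    congr 1
    ring
  · intro i _
    exact Continuous.intervalIntegrable (by fun_prop) _ _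

lemma mom_odd (m k : ℕ) (h : ¬ Even (m + k)) :
    ∫ t in (-1 : ℝ)..1, t ^ m * legendreP k t = 0 := by
  rw [mom]
  rw [Finset.sum_eq_zero, mul_zero]
  intro i hi
  have hi' : i ≤ k := by simp at hi; omega
  by_cases h' : Even (k + i)
  · have : Even (m + i + 1) := by grind
    simp [this.neg_one_pow]
  · rw [genChoose_zero k i hi' h']; simp

open Polynomial in
/-- The polynomial `k! * C((k+y-1)/2, k)` in `y`. -/
noncomputable def qPoly (k : ℕ) : ℝ[X] :=
  ∏ l ∈ Finset.range k, (C (1 / 2) * X + C (((k : ℝ) - 1) / 2 - l))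

lemma qPoly_eval (k : ℕ) (y : ℝ) : (qPoly k).eval y
    = ∏ l ∈ Finset.range k, (((k : ℝ) + y - 1) / 2 - l) := by
  unfold qPoly
  rw [Polynomial.eval_prod]
  refine Finset.prod_congr rfl fun i _ => ?_
  simp; ring

lemma qPoly_natDegree (k : ℕ) : (qPoly k).natDegree ≤ k := by
  unfold qPoly
  refine (Polynomial.natDegree_prod_le _ _).trans ?_
  refine (Finset.sum_le_card_nsmul _ _ 1 fun l _ => ?_).trans (by simp)
  exact Polynomial.natDegree_linear_le

lemma mom_even (m k : ℕ) (h : Even (m + k)) :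
    ∫ t in (-1 : ℝ)..1, t ^ m * legendreP k t
      = 2 ^ (k + 1) * (-1) ^ k * (qPoly k).eval (-((m : ℝ) + 1)) /
          ∏ j ∈ Finset.range (k + 1), ((m : ℝ) + 1 + (j : ℝ)) := by
  have hk : (k.factorial : ℝ) ≠ 0 := by positivity
  have h1 := aux_main k (qPoly k) (qPoly_natDegree k) ((m : ℝ) + 1) (by positivity)
  have h2 : ∑ i ∈ Finset.range (k + 1),
      (Nat.choose k i : ℝ) * genChoose (((k : ℝ) + (i : ℝ) - 1) / 2) k *
        ((1 - (-1) ^ (m + i + 1)) / ((i : ℝ) + (m + 1)))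
      = 2 / (k.factorial : ℝ) * ∑ i ∈ Finset.range (k + 1), (-1 : ℝ) ^ (k - i) *
        (k.choose i : ℝ) * ((qPoly k).eval (i : ℝ) / (i + ((m : ℝ) + 1))) := by
    rw [Finset.mul_sum]
    refine Finset.sum_congr rfl fun i hi => ?_
    have hi' : i ≤ k := by simp at hi; omega
    have hq : (qPoly k).eval (i : ℝ)
        = k.factorial * genChoose (((k : ℝ) + (i : ℝ) - 1) / 2) k := by
      rw [qPoly_eval, genChoose]; field_simp
    rw [hq]
    by_cases h' : Even (k + i)
    · have a1 : Odd (m + i + 1) := by grind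
      have a2 : Even (k - i) := by grind
      rw [a1.neg_one_pow, a2.neg_one_pow]
      field_simp
      ring
    · rw [genChoose_zero k i hi' h']; simp
  rw [mom, h2, h1]
  field_simp
  ring

lemma mom_lt (m k : ℕ) (hmk : m < k) :
    ∫ t in (-1 : ℝ)..1, t ^ m * legendreP k t = 0 := by
  by_cases h : Even (m + k)
  · rw [mom_even m k h, qPoly_eval]
    obtain ⟨j, hj⟩ := h
    have hj' : (m : ℝ) + k = j + j := by exact_mod_cast hj
    rw [Finset.prod_eq_zero (i := k - 1 - j) (by simp; omega)]
    · simp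
    · rw [Nat.cast_sub (by omega), Nat.cast_sub (by omega)]
      push_cast
      linarith
  · exact mom_odd m k h

/-- Leading coefficient. -/
noncomputable def leadC (k : ℕ) : ℝ := 2 ^ k * genChoose (((k : ℝ) + (k : ℝ) - 1) / 2) k

lemma leadC_eq (k : ℕ) :
    leadC k * k.factorial = ∏ l ∈ Finset.range k, (2 * (l : ℝ) + 1) := by
  have hk : (k.factorial : ℝ) ≠ 0 := by positivity
  unfold leadC genChoose
  rw [mul_assoc, div_mul_cancel₀ _ hk, ← Finset.prod_range_reflect]
  conv_lhs => rw [← Finset.card_range k, ← Finset.prod_const, Finset.card_range,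
    ← Finset.prod_mul_distrib]
  refine Finset.prod_congr rfl fun l hl => ?_
  simp at hl
  rw [Nat.cast_sub (by omega), Nat.cast_sub (by omega)]
  push_cast
  ring

lemma leadC_ne (k : ℕ) : leadC k ≠ 0 := by
  intro h
  have := leadC_eq k
  rw [h, zero_mul] at this
  have h2 : 0 < ∏ l ∈ Finset.range k, (2 * (l : ℝ) + 1) :=
    Finset.prod_pos fun l _ => by positivity
  linarith

lemma fact1 (k n : ℕ) : (k.factorial : ℝ) * ∏ j ∈ Finset.range n, ((k : ℝ) + 1 + j)
    = (k + n).factorial := by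
  induction n with
  | zero => simp
  | succ n ih =>
    rw [Finset.prod_range_succ, ← mul_assoc, ih, ← add_assoc, Nat.factorial_succ]
    push_cast; ring

lemma fact2 (k : ℕ) : 2 ^ k * (k.factorial : ℝ) * ∏ l ∈ Finset.range k, (2 * (l : ℝ) + 1)
    = (2 * k).factorial := by
  induction k with
  | zero => simp
  | succ n ih =>
    rw [Finset.prod_range_succ, show 2 * (n + 1) = 2 * n + 1 + 1 by ring, Nat.factorial_succ,
      Nat.factorial_succ, Nat.factorial_succ]
    push_cast
    rw [← ih]; ring

lemma mom_eq (k : ℕ) :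
    leadC k * ∫ t in (-1 : ℝ)..1, t ^ k * legendreP k t = 2 / (2 * k + 1) := by
  have hk : (k.factorial : ℝ) ≠ 0 := by positivity
  rw [mom_even k k (by simp), qPoly_eval]
  have e1 : ∏ l ∈ Finset.range k, (((k : ℝ) + -((k : ℝ) + 1) - 1) / 2 - l)
      = (-1) ^ k * k.factorial := by
    rw [← Finset.prod_range_add_one_eq_factorial, Nat.cast_prod]
    conv_rhs => rw [← Finset.card_range k, ← Finset.prod_const, Finset.card_range,
      ← Finset.prod_mul_distrib]
    refine Finset.prod_congr rfl fun l hl => ?_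
    push_cast; ring
  rw [e1, Finset.prod_range_succ]
  have f1 := fact1 k k
  have f2 := fact2 k
  rw [← leadC_eq, two_mul, ← f1] at f2
  have p1 : 0 < ∏ j ∈ Finset.range k, ((k : ℝ) + 1 + (j : ℝ)) :=
    Finset.prod_pos fun j _ => by positivity
  generalize ∏ j ∈ Finset.range k, ((k : ℝ) + 1 + (j : ℝ)) = A at *
  have f3 : 2 ^ k * (leadC k * k.factorial) = A := by
    apply mul_left_cancel₀ hk; rw [← f2]; ring
  have hs : ((-1 : ℝ) ^ k) * (-1) ^ k = 1 := by rw [← mul_pow]; simp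
  have hA : leadC k * (2 ^ (k + 1) * (-1) ^ k * ((-1) ^ k * (k.factorial : ℝ))) = 2 * A := by
    rw [← f3]; linear_combination (2 ^ (k+1) * leadC k * k.factorial) * hs
  rw [← mul_div_assoc, hA]
  have : (k : ℝ) + 1 + k = 2 * k + 1 := by ring
  rw [this]
  field_simp

/-- Leading term split. -/
lemma legendreP_split (k : ℕ) (t : ℝ) : legendreP k t = leadC k * t ^ k +
    ∑ i ∈ Finset.range k, 2 ^ k * ((Nat.choose k i : ℝ) *
      genChoose (((k : ℝ) + (i : ℝ) - 1) / 2) k) * t ^ i := by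
  unfold legendreP leadC
  rw [Finset.sum_range_succ, mul_add, Finset.mul_sum, add_comm]
  congr 1
  · simp; ring
  · refine Finset.sum_congr rfl fun i _ => ?_
    ring

lemma ii_sum {ι : Type*} (s : Finset ι) (f : ι → ℝ → ℝ)
    (hf : ∀ i ∈ s, IntervalIntegrable (f i) MeasureTheory.volume (-1) 1) :
    IntervalIntegrable (fun t => ∑ i ∈ s, f i t) MeasureTheory.volume (-1) 1 := by
  have h := IntervalIntegrable.sum s hf
  have e : (∑ i ∈ s, f i) = fun t => ∑ i ∈ s, f i t := by
    ext t; simp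
  rwa [e] at h

/-- If `h` is integrable against `t^i`, and orthogonal to lower powers, then the inner product
with `P_k` only sees the leading term. -/
lemma integral_mul_P (h : ℝ → ℝ)
    (hh : ∀ i : ℕ, IntervalIntegrable (fun t => h t * t ^ i) MeasureTheory.volume (-1) 1) (k : ℕ) :
    ∫ t in (-1 : ℝ)..1, h t * legendreP k t = leadC k * (∫ t in (-1 : ℝ)..1, h t * t ^ k) +
      ∑ i ∈ Finset.range k, 2 ^ k * ((Nat.choose k i : ℝ) *
      genChoose (((k : ℝ) + (i : ℝ) - 1) / 2) k) * ∫ t in (-1 : ℝ)..1, h t * t ^ i := by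
  have : ∀ t, h t * legendreP k t = leadC k * (h t * t ^ k) + ∑ i ∈ Finset.range k,
      2 ^ k * ((Nat.choose k i : ℝ) *
      genChoose (((k : ℝ) + (i : ℝ) - 1) / 2) k) * (h t * t ^ i) := by
    intro t
    rw [legendreP_split, mul_add, Finset.mul_sum]
    congr 1
    · ring
    · refine Finset.sum_congr rfl fun i _ => ?_
      ring
  simp_rw [this]
  rw [intervalIntegral.integral_add, intervalIntegral.integral_const_mul,
    intervalIntegral.integral_finsetSum]
  · simp_rw [intervalIntegral.integral_const_mul]
  · intro i _
    exact (hh i).const_mul _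
  · exact (hh k).const_mul _
  · exact ii_sum _ _ fun i _ => (hh i).const_mul _

lemma P_orth_lt (j k : ℕ) (hjk : j < k) :
    ∫ t in (-1 : ℝ)..1, legendreP k t * legendreP j t = 0 := by
  rw [integral_mul_P]
  · have : ∀ i < k, ∫ t in (-1 : ℝ)..1, legendreP k t * t ^ i = 0 := by
      intro i hi
      simp_rw [mul_comm (legendreP k _)]
      exact mom_lt i k hi
    rw [this j hjk, Finset.sum_eq_zero]
    · simp
    · intro i hi
      simp at hi
      rw [this i (by omega), mul_zero]
  · intro i
    have := continuous_legendreP k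
    exact Continuous.intervalIntegrable (by fun_prop) _ _

lemma P_norm (k : ℕ) :
    ∫ t in (-1 : ℝ)..1, legendreP k t * legendreP k t = 2 / (2 * k + 1) := by
  rw [integral_mul_P]
  · have : ∀ i, ∫ t in (-1 : ℝ)..1, legendreP k t * t ^ i
        = ∫ t in (-1 : ℝ)..1, t ^ i * legendreP k t := by
      intro i
      simp_rw [mul_comm (legendreP k _)]
    rw [this, mom_eq, Finset.sum_eq_zero]
    · simp
    · intro i hi
      simp at hi
      rw [this, mom_lt i k hi, mul_zero]
  · intro i
    have := continuous_legendreP k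
    exact Continuous.intervalIntegrable (by fun_prop) _ _

lemma P_orth (j k : ℕ) :
    ∫ t in (-1 : ℝ)..1, legendreP j t * legendreP k t = if j = k then 2 / (2 * (k : ℝ) + 1) else 0 := by
  rcases lt_trichotomy j k with h | h | h
  · rw [if_neg h.ne, ← P_orth_lt j k h]
    simp_rw [mul_comm]
  · subst h; rw [if_pos rfl, P_norm]
  · rw [if_neg h.ne', P_orth_lt k j h]

lemma intervalIntegrable_step (a : ℝ) (f : ℝ → ℝ) (hf : Continuous f) :
    IntervalIntegrable (fun t => (if a ≤ t then (1 : ℝ) else 0) * f t)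
      MeasureTheory.volume (-1) 1 := by
  have h : (fun t => (if a ≤ t then (1 : ℝ) else 0) * f t) = (Set.Ici a).indicator f := by
    ext t; simp [Set.indicator_apply]
  rw [h, intervalIntegrable_iff]
  exact ((intervalIntegrable_iff.mp (hf.intervalIntegrable _ _))).indicator measurableSet_Ici

lemma integral_step (a : ℝ) (ha : a ∈ Set.Icc (-1 : ℝ) 1) (f : ℝ → ℝ) (hf : Continuous f) :
    ∫ t in (-1 : ℝ)..1, (if a ≤ t then (1 : ℝ) else 0) * f t = ∫ t in a..1, f t := by
  have hI := intervalIntegrable_step a f hf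
  have hsub1 : Set.uIcc (-1 : ℝ) a ⊆ Set.uIcc (-1 : ℝ) 1 := by
    rw [Set.uIcc_of_le ha.1, Set.uIcc_of_le (by norm_num)]
    exact Set.Icc_subset_Icc_right ha.2
  have hsub2 : Set.uIcc a (1 : ℝ) ⊆ Set.uIcc (-1 : ℝ) 1 := by
    rw [Set.uIcc_of_le ha.2, Set.uIcc_of_le (by norm_num)]
    exact Set.Icc_subset_Icc_left ha.1
  rw [← intervalIntegral.integral_add_adjacent_intervals (b := a) (hI.mono_set hsub1)
    (hI.mono_set hsub2)]
  have z1 : ∫ t in (-1 : ℝ)..a, (if a ≤ t then (1 : ℝ) else 0) * f t = 0 := by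
    rw [intervalIntegral.integral_of_le ha.1, MeasureTheory.integral_Ioc_eq_integral_Ioo]
    rw [MeasureTheory.setIntegral_congr_fun (g := fun _ => (0 : ℝ)) measurableSet_Ioo]
    · simp
    · intro t ht
      simp [not_le.mpr ht.2]
  rw [z1, zero_add]
  apply intervalIntegral.integral_congr
  intro t ht
  rw [Set.uIcc_of_le ha.2] at ht
  simp [ht.1]

lemma eCDF_mul {N : ℕ} (x : Fin N → ℝ) (f : ℝ → ℝ) (t : ℝ) : eCDF x t * f t
    = (1 / (N : ℝ)) * ∑ n, (if x n ≤ t then (1 : ℝ) else 0) * f t := by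
  unfold eCDF; rw [mul_assoc, Finset.sum_mul]

lemma eCDF_int {N : ℕ} (x : Fin N → ℝ) (f : ℝ → ℝ) (hf : Continuous f) :
    IntervalIntegrable (fun t => eCDF x t * f t) MeasureTheory.volume (-1) 1 := by
  simp_rw [eCDF_mul]
  exact (ii_sum _ _ fun n _ => intervalIntegrable_step (x n) f hf).const_mul _

lemma eCDF_pow {N : ℕ} (hN : 1 ≤ N) (x : Fin N → ℝ) (hx : ∀ n, x n ∈ Set.Icc (-1 : ℝ) 1) (i : ℕ) :
    ∫ t in (-1 : ℝ)..1, eCDF x t * t ^ i = (1 - empMoment x (i + 1)) / (i + 1) := by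
  have hN' : (N : ℝ) ≠ 0 := by positivity
  simp_rw [eCDF_mul x (fun t => t ^ i)]
  rw [intervalIntegral.integral_const_mul, intervalIntegral.integral_finsetSum]
  · simp_rw [fun n => integral_step (x n) (hx n) (fun t => t ^ i) (by fun_prop), integral_pow]
    rw [← Finset.sum_div, Finset.sum_sub_distrib]
    unfold empMoment
    simp
    field_simp
  · intro n _
    exact intervalIntegrable_step (x n) _ (by fun_prop)

lemma eCDF_P {N : ℕ} (hN : 1 ≤ N) (x : Fin N → ℝ) (hx : ∀ n, x n ∈ Set.Icc (-1 : ℝ) 1) (k : ℕ) :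
    ∫ t in (-1 : ℝ)..1, eCDF x t * legendreP k t
      = 2 ^ k * ∑ i ∈ Finset.range (k + 1), coefB k i * (1 - empMoment x (i + 1)) := by
  rw [integral_mul_P _ fun i => eCDF_int x _ (by fun_prop)]
  simp_rw [eCDF_pow hN x hx]
  rw [Finset.sum_range_succ, mul_add, Finset.mul_sum, add_comm]
  congr 1
  · refine Finset.sum_congr rfl fun i _ => ?_
    unfold coefB; ring
  · unfold coefB leadC; simp; ring

lemma continuous_Fhat {N : ℕ} (x : Fin N → ℝ) (K : ℕ) : Continuous (Fhat x K) := by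
  have := continuous_legendreP
  unfold Fhat legendreE; fun_prop

lemma Fhat_P {N : ℕ} (hN : 1 ≤ N) (x : Fin N → ℝ) (hx : ∀ n, x n ∈ Set.Icc (-1 : ℝ) 1) (K k : ℕ)
    (hk : k ≤ K) : ∫ t in (-1 : ℝ)..1, Fhat x K t * legendreP k t
      = ∫ t in (-1 : ℝ)..1, eCDF x t * legendreP k t := by
  have hc := continuous_legendreP
  rw [eCDF_P hN x hx]
  have : ∀ t, Fhat x K t * legendreP k t = ∑ j ∈ Finset.range (K + 1),
      (coefA j * (∑ i ∈ Finset.range (j + 1), coefB j i * (1 - empMoment x (i + 1))) *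
      Real.sqrt ((2 * (j : ℝ) + 1) / 2)) * (legendreP j t * legendreP k t) := by
    intro t
    unfold Fhat legendreE
    rw [Finset.sum_mul]
    refine Finset.sum_congr rfl fun j _ => ?_
    ring
  simp_rw [this]
  rw [intervalIntegral.integral_finsetSum]
  · simp_rw [intervalIntegral.integral_const_mul, P_orth]
    simp only [mul_ite, mul_zero, Finset.sum_ite_eq', Finset.mem_range]
    rw [if_pos (by omega)]
    unfold coefA
    have hs : Real.sqrt ((2 * (k : ℝ) + 1) / 2) * Real.sqrt ((2 * (k : ℝ) + 1) / 2)
      = (2 * (k : ℝ) + 1) / 2 := Real.mul_self_sqrt (by positivity)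
    generalize Real.sqrt ((2 * (k : ℝ) + 1) / 2) = s at *
    generalize ∑ i ∈ Finset.range (k + 1), coefB k i * (1 - empMoment x (i + 1)) = S
    have e : 2 ^ k * s * S * s * (2 / (2 * (k : ℝ) + 1))
      = 2 ^ k * S * (2 / (2 * (k : ℝ) + 1)) * (s * s) := by ring
    rw [e, hs]
    field_simp
  · intro j _
    exact Continuous.intervalIntegrable (by fun_prop) _ _

lemma diff_int {N : ℕ} (x : Fin N → ℝ) (K : ℕ) (f : ℝ → ℝ) (hf : Continuous f) :
    IntervalIntegrable (fun t => (eCDF x t - Fhat x K t) * f t) MeasureTheory.volume (-1) 1 := by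
  simp_rw [sub_mul]
  exact (eCDF_int x f hf).sub (((continuous_Fhat x K).mul hf).intervalIntegrable _ _)

lemma diff_pow {N : ℕ} (hN : 1 ≤ N) (x : Fin N → ℝ) (hx : ∀ n, x n ∈ Set.Icc (-1 : ℝ) 1) (K : ℕ) :
    ∀ m ≤ K, ∫ t in (-1 : ℝ)..1, (eCDF x t - Fhat x K t) * t ^ m = 0 := by
  intro m
  induction m using Nat.strong_induction_on with
  | _ m ih =>
    intro hm
    have h1 := integral_mul_P (fun t => eCDF x t - Fhat x K t)
      (fun i => diff_int x K _ (by fun_prop)) m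
    rw [Finset.sum_eq_zero (fun i hi => by
      simp at hi
      rw [ih i hi (by omega), mul_zero])] at h1
    have h2 : ∫ t in (-1 : ℝ)..1, (eCDF x t - Fhat x K t) * legendreP m t = 0 := by
      simp_rw [sub_mul]
      rw [intervalIntegral.integral_sub (eCDF_int x _ (continuous_legendreP m))
        (Continuous.intervalIntegrable (u := fun t => Fhat x K t * legendreP m t)
      ((continuous_Fhat x K).mul (continuous_legendreP m)) _ _),
        Fhat_P hN x hx K m hm, sub_self]
    rw [h2, add_zero] at h1
    exact (mul_eq_zero.mp h1.symm).resolve_left (leadC_ne m)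

lemma diff_poly {N : ℕ} (hN : 1 ≤ N) (x : Fin N → ℝ) (hx : ∀ n, x n ∈ Set.Icc (-1 : ℝ) 1) (K : ℕ)
    (g : Polynomial ℝ) (hg : g.natDegree ≤ K) :
    ∫ t in (-1 : ℝ)..1, (eCDF x t - Fhat x K t) * g.eval t = 0 := by
  have : ∀ t, (eCDF x t - Fhat x K t) * g.eval t = ∑ i ∈ Finset.range (K + 1),
      g.coeff i * ((eCDF x t - Fhat x K t) * t ^ i) := by
    intro t
    rw [Polynomial.eval_eq_sum_range' (n := K + 1) (by omega), Finset.mul_sum]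
    refine Finset.sum_congr rfl fun i _ => ?_
    ring
  simp_rw [this]
  rw [intervalIntegral.integral_finsetSum]
  · refine Finset.sum_eq_zero fun i hi => ?_
    simp at hi
    rw [intervalIntegral.integral_const_mul, diff_pow hN x hx K i (by omega), mul_zero]
  · intro i _
    exact (diff_int x K _ (by fun_prop)).const_mul _

lemma diff_P {N : ℕ} (hN : 1 ≤ N) (x : Fin N → ℝ) (hx : ∀ n, x n ∈ Set.Icc (-1 : ℝ) 1) (K k : ℕ)
    (hk : k ≤ K) :
    ∫ t in (-1 : ℝ)..1, (eCDF x t - Fhat x K t) * legendreP k t = 0 := by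
  simp_rw [sub_mul]
  rw [intervalIntegral.integral_sub (eCDF_int x _ (continuous_legendreP k))
    (Continuous.intervalIntegrable (u := fun t => Fhat x K t * legendreP k t)
      ((continuous_Fhat x K).mul (continuous_legendreP k)) _ _),
    Fhat_P hN x hx K k hk, sub_self]

lemma diff_Fhat {N : ℕ} (hN : 1 ≤ N) (x : Fin N → ℝ) (hx : ∀ n, x n ∈ Set.Icc (-1 : ℝ) 1) (K : ℕ) :
    ∫ t in (-1 : ℝ)..1, (eCDF x t - Fhat x K t) * Fhat x K t = 0 := by
  have : ∀ t, (eCDF x t - Fhat x K t) * Fhat x K t = ∑ j ∈ Finset.range (K + 1),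
      (coefA j * (∑ i ∈ Finset.range (j + 1), coefB j i * (1 - empMoment x (i + 1))) *
      Real.sqrt ((2 * (j : ℝ) + 1) / 2)) * ((eCDF x t - Fhat x K t) * legendreP j t) := by
    intro t
    generalize eCDF x t - Fhat x K t = d
    unfold Fhat legendreE
    rw [Finset.mul_sum]
    refine Finset.sum_congr rfl fun j _ => ?_
    ring
  simp_rw [this]
  rw [intervalIntegral.integral_finsetSum]
  · refine Finset.sum_eq_zero fun i hi => ?_
    simp at hi
    rw [intervalIntegral.integral_const_mul, diff_P hN x hx K i (by omega), mul_zero]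
  · intro i _
    exact (diff_int x K _ (continuous_legendreP i)).const_mul _

lemma eCDF_sq_int {N : ℕ} (x : Fin N → ℝ) :
    IntervalIntegrable (fun t => eCDF x t * eCDF x t) MeasureTheory.volume (-1) 1 := by
  simp_rw [eCDF_mul x (eCDF x)]
  refine (ii_sum _ _ fun n _ => ?_).const_mul _
  have h0 := eCDF_int x (fun _ => 1) continuous_const
  have h : (fun t => (if x n ≤ t then (1 : ℝ) else 0) * eCDF x t)
      = (Set.Ici (x n)).indicator (fun t => eCDF x t * 1) := by
    ext t; simp [Set.indicator_apply]
  rw [h, intervalIntegrable_iff]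
  exact (intervalIntegrable_iff.mp h0).indicator measurableSet_Ici

/-- `F̂` is the best `L²`-approximation of the empirical CDF among polynomials of
degree at most `K`. -/
theorem Fhat_best_L2_approximation
    (N : ℕ) (hN : 1 ≤ N)
    (x : Fin N → ℝ) (hx : ∀ n, x n ∈ Set.Icc (-1 : ℝ) 1)
    (K : ℕ) (g : Polynomial ℝ) (hg : g.natDegree ≤ K) :
    ∫ t in (-1 : ℝ)..1, (eCDF x t - Fhat x K t) ^ 2
      ≤ ∫ t in (-1 : ℝ)..1, (eCDF x t - g.eval t) ^ 2 := by
  have hgc : Continuous fun t => g.eval t := g.continuous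
  have hFc := continuous_Fhat x K
  have e : ∀ t, (eCDF x t - g.eval t) ^ 2 = (eCDF x t - Fhat x K t) ^ 2 +
      (2 * ((eCDF x t - Fhat x K t) * Fhat x K t - (eCDF x t - Fhat x K t) * g.eval t) +
      (Fhat x K t - g.eval t) ^ 2) := by
    intro t; ring
  have i1 : IntervalIntegrable (fun t => (eCDF x t - Fhat x K t) ^ 2)
      MeasureTheory.volume (-1) 1 := by
    have : (fun t => (eCDF x t - Fhat x K t) ^ 2) = fun t => eCDF x t * eCDF x t -
        (eCDF x t * Fhat x K t + (eCDF x t - Fhat x K t) * Fhat x K t) := by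
      ext t; ring
    rw [this]
    exact (eCDF_sq_int x).sub ((eCDF_int x _ hFc).add (diff_int x K _ hFc))
  have i2 := (diff_int x K _ hFc)
  have i3 := (diff_int x K _ hgc)
  have i4 : IntervalIntegrable (fun t => (Fhat x K t - g.eval t) ^ 2)
      MeasureTheory.volume (-1) 1 := Continuous.intervalIntegrable (by fun_prop) _ _
  simp_rw [e]
  rw [intervalIntegral.integral_add i1 (((i2.sub i3).const_mul 2).add i4),
    intervalIntegral.integral_add ((i2.sub i3).const_mul 2) i4,
    intervalIntegral.integral_const_mul, intervalIntegral.integral_sub i2 i3,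
    diff_Fhat hN x hx K, diff_poly hN x hx K g hg]
  have : 0 ≤ ∫ t in (-1 : ℝ)..1, (Fhat x K t - g.eval t) ^ 2 :=
    intervalIntegral.integral_nonneg (by norm_num) fun t _ => sq_nonneg _
  linarith
end
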